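/- Let G be a finite abelian group with D(G) ≥ 4 and suppose 𝓛(G) = 𝓛(G') for a finite abelian group G'. Then for every d ∈ Δ1(G): d ∈ Δ1(G'), ρ(G, d) = ρ(G', d), and ρ*(G, d) = ρ*(G', d). -/

import Mathlib

/- Common definitions: zero-sum sequences over a finite abelian group,
   sets of lengths, the system of sets of lengths, the Davenport constant,
   sets of distances, elasticities, AAPs, Δ₁(G), ρ(G,d,k), ρ(G,d), ρ*(G,d),
   cross numbers, K(G₀), K(G,d), LCN-sets, Δ*(G). -/

open scoped Classical

section Defs

variable {G : Type*} [AddCommGroup G]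

/-- The support of a sequence (multiset) over `G`. -/
def suppSet (A : Multiset G) : Set G := {g | g ∈ A}

/-- `A` is a minimal zero-sum sequence (an atom of `𝓑(G₀)`) over `G₀ ⊆ G`:
a nontrivial zero-sum sequence with terms in `G₀` such that every proper
nontrivial subsequence has nonzero sum. -/
def IsMinZeroSum (G0 : Set G) (A : Multiset G) : Prop :=
  A ≠ 0 ∧ (∀ g ∈ A, g ∈ G0) ∧ A.sum = 0 ∧
    ∀ T : Multiset G, T ≤ A → T.sum = 0 → T = 0 ∨ T = A

/-- `B` is a zero-sum sequence over `G₀ ⊆ G` (an element of `𝓑(G₀)`). -/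
def IsZeroSumSeq (G0 : Set G) (B : Multiset G) : Prop :=
  (∀ g ∈ B, g ∈ G0) ∧ B.sum = 0

/-- The set of lengths `L(B)` of a zero-sum sequence `B` over `G₀`:
all `k` such that `B` is a product of `k` atoms of `𝓑(G₀)`.
(For the trivial sequence this is `{0}`.) -/
def lengthSet (G0 : Set G) (B : Multiset G) : Set ℕ :=
  {k | ∃ U : Fin k → Multiset G, (∀ i, IsMinZeroSum G0 (U i)) ∧ B = ∑ i, U i}

/-- The system of sets of lengths `𝓛(G₀)`. -/
def systemL (G0 : Set G) : Set (Set ℕ) :=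
  {L | ∃ B : Multiset G, IsZeroSumSeq G0 B ∧ L = lengthSet G0 B}

/-- The Davenport constant `D(G)`: the maximal length of a minimal zero-sum
sequence over `G`. -/
noncomputable def davenport (G : Type*) [AddCommGroup G] : ℕ :=
  sSup {m | ∃ A : Multiset G, IsMinZeroSum (Set.univ : Set G) A ∧ Multiset.card A = m}

/-- The set of successive distances `Δ(L)` of a set `L ⊆ ℕ`. -/
def deltaOf (L : Set ℕ) : Set ℕ :=
  {d | 0 < d ∧ ∃ a, a ∈ L ∧ a + d ∈ L ∧ ∀ c ∈ L, ¬(a < c ∧ c < a + d)}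

/-- `Δ(G₀) = ⋃_{L ∈ 𝓛(G₀)} Δ(L)`. -/
def deltaG0 (G0 : Set G) : Set ℕ := ⋃ L ∈ systemL G0, deltaOf L

/-- `Δ*(G) = {min Δ(G₀) : G₀ ⊆ G with Δ(G₀) ≠ ∅}`. -/
def deltaStar (G : Type*) [AddCommGroup G] : Set ℕ :=
  {d | ∃ G0 : Set G, deltaG0 G0 ≠ ∅ ∧ d = sInf (deltaG0 G0)}

/-- The elasticity `ρ(L) = max L / min L` of a (finite) set `L ⊆ ℕ`,
with the convention `ρ({0}) = 1`. -/
noncomputable def rhoL (L : Set ℕ) : ℝ :=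
  if sInf L = 0 then 1 else ((sSup L : ℕ) : ℝ) / ((sInf L : ℕ) : ℝ)

/-- The elasticity `ρ(G₀) = sup {ρ(L) : L ∈ 𝓛(G₀)}`. -/
noncomputable def rhoG0 (G0 : Set G) : ℝ := sSup (rhoL '' systemL G0)

/-- `L` (a set of naturals) is an almost arithmetical progression (AAP)
with difference `d`, length `ℓ` and bound `M`:
`L = y + (L' ∪ {0, d, …, ℓd} ∪ L'') ⊆ y + dℤ` with `L' ⊆ [−M, −1]` and
`L'' ⊆ ℓd + [1, M]`. -/
def IsAAP (L : Set ℕ) (d ℓ M : ℕ) : Prop :=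
  ∃ (y : ℤ) (L1 L2 : Set ℤ),
    L1 ⊆ Set.Icc (-(M : ℤ)) (-1) ∧
    L2 ⊆ Set.Icc ((ℓ : ℤ) * d + 1) ((ℓ : ℤ) * d + M) ∧
    ((fun x : ℕ => (x : ℤ)) '' L) =
      (fun x => y + x) '' (L1 ∪ (fun i : ℤ => (d : ℤ) * i) '' Set.Icc (0 : ℤ) (ℓ : ℤ) ∪ L2) ∧
    (∀ x ∈ L, (d : ℤ) ∣ ((x : ℤ) - y))

/-- `Δ₁(G)`: the set of `d ∈ ℕ` such that for every `k` there is some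
`L ∈ 𝓛(G)` which is an AAP with difference `d` and length at least `k`. -/
def delta1 (G : Type*) [AddCommGroup G] : Set ℕ :=
  {d | 0 < d ∧ ∀ k : ℕ, ∃ L ∈ systemL (Set.univ : Set G), ∃ ℓ ≥ k, ∃ M : ℕ, IsAAP L d ℓ M}

/-- `ρ(G, d, k)`: the supremum of elasticities of sets of lengths of `G` which
are AAPs with difference `d` and length at least `k`. -/
noncomputable def rhoGdk (G : Type*) [AddCommGroup G] (d k : ℕ) : ℝ :=
  sSup (rhoL '' {L | L ∈ systemL (Set.univ : Set G) ∧ ∃ ℓ ≥ k, ∃ M : ℕ, IsAAP L d ℓ M})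

/-- `ρ(G, d)`: the limit of the decreasing sequence `(ρ(G, d, k))_k`,
i.e. its infimum. -/
noncomputable def rhoGd (G : Type*) [AddCommGroup G] (d : ℕ) : ℝ :=
  ⨅ k : ℕ, rhoGdk G d k

/-- `ρ*(G, d) = max {ρ(G₀) : G₀ ⊆ G non-half-factorial with d ∣ min Δ(G₀)}`. -/
noncomputable def rhoStar (G : Type*) [AddCommGroup G] (d : ℕ) : ℝ :=
  sSup {x | ∃ G0 : Set G, deltaG0 G0 ≠ ∅ ∧ d ∣ sInf (deltaG0 G0) ∧ x = rhoG0 G0}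

/-- The cross number `k(S) = Σ_{g ∈ S} 1/ord(g)` of a sequence `S`. -/
noncomputable def crossNum (S : Multiset G) : ℝ :=
  (S.map (fun g => (1 : ℝ) / (addOrderOf g))).sum

/-- `K(G₀) = max {k(A) : A ∈ 𝓐(G₀)}`, the cross number of `G₀`. -/
noncomputable def KG0 (G0 : Set G) : ℝ :=
  sSup {x | ∃ A : Multiset G, IsMinZeroSum G0 A ∧ x = crossNum A}

/-- `K(G, d) = max {K(G₀) : G₀ ⊆ G non-half-factorial with d ∣ min Δ(G₀)}`. -/
noncomputable def KGd (G : Type*) [AddCommGroup G] (d : ℕ) : ℝ :=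
  sSup {x | ∃ G0 : Set G, deltaG0 G0 ≠ ∅ ∧ d ∣ sInf (deltaG0 G0) ∧ x = KG0 G0}

/-- `G₀` is an LCN-set: `k(A) ≥ 1` for every atom `A` of `𝓑(G₀)`. -/
def IsLCN (G0 : Set G) : Prop :=
  ∀ A : Multiset G, IsMinZeroSum G0 A → 1 ≤ crossNum A

end Defs

section Helpers

variable {G : Type*} [AddCommGroup G]

theorem mem_lengthSet_iff (G0 : Set G) (B : Multiset G) (k : ℕ) :
    k ∈ lengthSet G0 B ↔ ∃ V : Multiset (Multiset G), Multiset.card V = k ∧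
      (∀ U ∈ V, IsMinZeroSum G0 U) ∧ V.sum = B := by
  constructor
  · rintro ⟨U, hU, rfl⟩
    refine ⟨Finset.univ.val.map U, by simp, ?_, rfl⟩
    intro W hW
    rw [Multiset.mem_map] at hW
    obtain ⟨i, _, rfl⟩ := hW
    exact hU i
  · rintro ⟨V, hk, hV, rfl⟩
    induction V using Quotient.inductionOn with
    | h l =>
      simp only [Multiset.quot_mk_to_coe, Multiset.coe_card, Multiset.mem_coe,
        Multiset.sum_coe] at hk hV ⊢
      subst hk
      refine ⟨fun i => l.get i, fun i => hV _ (List.get_mem l i), ?_⟩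
      conv_lhs => rw [← List.ofFn_get l]
      rw [List.sum_ofFn]

theorem lengthSet_add {G0 : Set G} {A B : Multiset G} {a b : ℕ}
    (ha : a ∈ lengthSet G0 A) (hb : b ∈ lengthSet G0 B) : a + b ∈ lengthSet G0 (A + B) := by
  rw [mem_lengthSet_iff] at *
  obtain ⟨V, rfl, hV, rfl⟩ := ha
  obtain ⟨W, rfl, hW, rfl⟩ := hb
  refine ⟨V + W, by simp, ?_, by simp⟩
  intro U hU
  rcases Multiset.mem_add.1 hU with h | h
  · exact hV U h
  · exact hW U h

theorem zero_mem_lengthSet (G0 : Set G) : 0 ∈ lengthSet G0 (0 : Multiset G) := by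
  rw [mem_lengthSet_iff]
  exact ⟨0, by simp⟩

theorem lengthSet_nsmul {G0 : Set G} {A : Multiset G} {a : ℕ}
    (ha : a ∈ lengthSet G0 A) (n : ℕ) : n * a ∈ lengthSet G0 (n • A) := by
  induction n with
  | zero => simpa using zero_mem_lengthSet G0
  | succ n ih =>
    have := lengthSet_add ih ha
    rwa [← succ_nsmul, ← Nat.succ_mul] at this

theorem lengthSet_mono {G0 G1 : Set G} (h : G0 ⊆ G1) {B : Multiset G} {k : ℕ}
    (hk : k ∈ lengthSet G0 B) : k ∈ lengthSet G1 B := by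
  rw [mem_lengthSet_iff] at *
  obtain ⟨V, rfl, hV, rfl⟩ := hk
  exact ⟨V, rfl, fun U hU => ⟨(hV U hU).1, fun g hg => h ((hV U hU).2.1 g hg), (hV U hU).2.2⟩, rfl⟩

theorem lengthSet_restrict {G0 G1 : Set G} {B : Multiset G} (hB : ∀ g ∈ B, g ∈ G0) {k : ℕ}
    (hk : k ∈ lengthSet G1 B) : k ∈ lengthSet G0 B := by
  rw [mem_lengthSet_iff] at *
  obtain ⟨V, rfl, hV, rfl⟩ := hk
  exact ⟨V, rfl, fun U hU => ⟨(hV U hU).1, fun g hg => hB g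
    (Multiset.mem_of_le (Multiset.le_sum_of_mem hU) hg), (hV U hU).2.2⟩, rfl⟩

theorem lengthSet_univ_eq {G0 : Set G} {B : Multiset G} (hB : ∀ g ∈ B, g ∈ G0) :
    lengthSet (Set.univ : Set G) B = lengthSet G0 B :=
  Set.ext fun _ => ⟨lengthSet_restrict hB, lengthSet_mono (Set.subset_univ _)⟩

theorem card_le_sum_card (V : Multiset (Multiset G)) (hV : ∀ U ∈ V, U ≠ 0) :
    Multiset.card V ≤ Multiset.card V.sum := by
  induction V using Multiset.induction_on with
  | empty => simp
  | cons U V ih =>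
    have h1 := ih fun W hW => hV W (Multiset.mem_cons_of_mem hW)
    have h2 := Multiset.card_pos.2 (hV U (Multiset.mem_cons_self _ _))
    simp only [Multiset.card_cons, Multiset.sum_cons, Multiset.card_add]
    omega

theorem sum_card_le (V : Multiset (Multiset G)) (D : ℕ) (hV : ∀ U ∈ V, Multiset.card U ≤ D) :
    Multiset.card V.sum ≤ D * Multiset.card V := by
  induction V using Multiset.induction_on with
  | empty => simp
  | cons U V ih =>
    have h1 := ih fun W hW => hV W (Multiset.mem_cons_of_mem hW)
    have h2 := hV U (Multiset.mem_cons_self _ _)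
    simp only [Multiset.card_cons, Multiset.sum_cons, Multiset.card_add]
    rw [Nat.mul_add]; omega

theorem length_le_card {G0 : Set G} {B : Multiset G} {k : ℕ} (hk : k ∈ lengthSet G0 B) :
    k ≤ Multiset.card B := by
  rw [mem_lengthSet_iff] at hk
  obtain ⟨V, rfl, hV, rfl⟩ := hk
  exact card_le_sum_card V fun U hU => (hV U hU).1

/-- Every zero-sum sequence factors into atoms. -/
theorem exists_length {G0 : Set G} (n : ℕ) : ∀ B : Multiset G, Multiset.card B ≤ n →
    IsZeroSumSeq G0 B → ∃ k, k ∈ lengthSet G0 B := by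
  induction n with
  | zero =>
    intro B hB _
    have : B = 0 := by simpa using hB
    subst this
    exact ⟨0, zero_mem_lengthSet G0⟩
  | succ n ih =>
    intro B hB hz
    by_cases h0 : B = 0
    · subst h0
      exact ⟨0, zero_mem_lengthSet G0⟩
    by_cases hm : IsMinZeroSum G0 B
    · exact ⟨1, (mem_lengthSet_iff _ _ _).2 ⟨{B}, by simp, by simpa using hm, by simp⟩⟩
    · have : ∃ T : Multiset G, T ≤ B ∧ T.sum = 0 ∧ T ≠ 0 ∧ T ≠ B := by
        by_contra hcon
        push Not at hcon
        refine hm ⟨h0, hz.1, hz.2, fun T hT hs => ?_⟩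
        by_cases hT0 : T = 0
        · exact Or.inl hT0
        · exact Or.inr (hcon T hT hs hT0)
      obtain ⟨T, hT, hs, hT0, hTB⟩ := this
      obtain ⟨R, rfl⟩ := Multiset.le_iff_exists_add.1 hT
      have hR0 : R ≠ 0 := by rintro rfl; simp at hTB
      have c1 := Multiset.card_pos.2 hT0
      have c2 := Multiset.card_pos.2 hR0
      have hz2 := hz.2
      rw [Multiset.card_add] at hB
      rw [Multiset.sum_add, hs, zero_add] at hz2
      obtain ⟨a, ha⟩ := ih T (by omega) ⟨fun g hg => hz.1 g (by simp [hg]), hs⟩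
      obtain ⟨b, hb⟩ := ih R (by omega) ⟨fun g hg => hz.1 g (by simp [hg]), hz2⟩
      exact ⟨a + b, lengthSet_add ha hb⟩

theorem atom_card_le [Fintype G] {G0 : Set G} {A : Multiset G} (hA : IsMinZeroSum G0 A) :
    Multiset.card A ≤ Fintype.card G := by
  by_contra hcon
  push Not at hcon
  obtain ⟨l, rfl⟩ : ∃ l : List G, (l : Multiset G) = A := Quot.exists_rep A
  rw [Multiset.coe_card] at hcon
  obtain ⟨i, j, hij, he⟩ := Fintype.exists_ne_map_eq_of_card_lt
    (fun i : Fin l.length => (l.take i).sum) (by simpa using hcon)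
  have key : ∀ i j : Fin l.length, i < j → (l.take i).sum = (l.take j).sum → False := by
    intro i j hij he
    have hj := j.2
    have hij' : (i : ℕ) < j := hij
    set T := (l.take j).drop i with hT
    have hsum : (l.take i).sum + T.sum = (l.take j).sum := by
      rw [hT, ← List.sum_append]
      congr 1
      conv_rhs => rw [← List.take_append_drop i (l.take j)]
      rw [List.take_take, min_eq_left hij'.le]
    have hTs : T.sum = 0 := by rw [he] at hsum; simpa using hsum
    have hlen : T.length = j - i := by simp [hT]
    have hsub : T.Sublist l := (List.drop_sublist _ _).trans (List.take_sublist _ _)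
    rcases hA.2.2.2 (T : Multiset G) (Multiset.coe_le.2 hsub.subperm) (by simpa using hTs)
      with h | h
    · have := congrArg Multiset.card h
      simp at this; rw [this] at hlen; simp at hlen; omega
    · have := congrArg Multiset.card h
      simp at this; omega
  rcases lt_or_gt_of_ne hij with h | h
  · exact key i j h he
  · exact key j i h he.symm

theorem card_le_length [Fintype G] {G0 : Set G} {B : Multiset G} {k : ℕ}
    (hk : k ∈ lengthSet G0 B) : Multiset.card B ≤ Fintype.card G * k := by
  rw [mem_lengthSet_iff] at hk
  obtain ⟨V, rfl, hV, rfl⟩ := hk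
  exact sum_card_le V _ fun U hU => atom_card_le (hV U hU)

theorem cover (V : Multiset (Multiset G)) : ∀ R : Multiset G, R ≤ V.sum →
    ∃ J ≤ V, Multiset.card J ≤ Multiset.card R ∧ R ≤ J.sum := by
  induction V using Multiset.induction_on with
  | empty => intro R hR; exact ⟨0, le_rfl, by simp, by simpa using hR⟩
  | cons U V ih =>
    intro R hR
    rw [Multiset.sum_cons] at hR
    have h1 : R - U ≤ V.sum := by rw [tsub_le_iff_left]; exact hR
    obtain ⟨J, hJ, hc, hs⟩ := ih (R - U) h1
    by_cases hlt : Multiset.card (R - U) < Multiset.card R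
    · refine ⟨U ::ₘ J, Multiset.cons_le_cons _ hJ, by rw [Multiset.card_cons]; omega, ?_⟩
      rw [Multiset.sum_cons, ← tsub_le_iff_left]; exact hs
    · have : R - U = R := Multiset.eq_of_le_of_card_le (tsub_le_self) (by omega)
      rw [this] at hc hs
      exact ⟨J, hJ.trans (Multiset.le_cons_self _ _), hc, hs⟩

theorem exists_delta {L : Set ℕ} {a b : ℕ} (ha : a ∈ L) (hb : b ∈ L) (hab : a < b) :
    ∃ e ∈ deltaOf L, e ≤ b - a := by
  have hex : ∃ e, 0 < e ∧ a + e ∈ L := ⟨b - a, by omega, by rwa [Nat.add_sub_cancel' hab.le]⟩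
  have hs := Nat.find_spec hex
  refine ⟨Nat.find hex, ⟨hs.1, a, ha, hs.2, ?_⟩, Nat.find_min' hex
    ⟨by omega, by rwa [Nat.add_sub_cancel' hab.le]⟩⟩
  rintro c hc ⟨h1, h2⟩
  exact Nat.find_min hex (m := c - a) (by omega) ⟨by omega, by rwa [Nat.add_sub_cancel' h1.le]⟩

theorem mem_deltaG0 {G0 : Set G} {e : ℕ} : e ∈ deltaG0 G0 ↔
    ∃ B, IsZeroSumSeq G0 B ∧ e ∈ deltaOf (lengthSet G0 B) := by
  simp only [deltaG0, systemL, Set.mem_iUnion, Set.mem_ofPred_eq]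
  constructor
  · rintro ⟨L, ⟨B, hB, rfl⟩, h⟩; exact ⟨B, hB, h⟩
  · rintro ⟨B, hB, h⟩; exact ⟨_, ⟨B, hB, rfl⟩, h⟩

theorem isZeroSumSeq_add {G0 : Set G} {A B : Multiset G} (hA : IsZeroSumSeq G0 A)
    (hB : IsZeroSumSeq G0 B) : IsZeroSumSeq G0 (A + B) := by
  refine ⟨fun g hg => ?_, by rw [Multiset.sum_add, hA.2, hB.2, add_zero]⟩
  rcases Multiset.mem_add.1 hg with h | h
  · exact hA.1 g h
  · exact hB.1 g h

theorem isZeroSumSeq_nsmul {G0 : Set G} {A : Multiset G} (hA : IsZeroSumSeq G0 A) (n : ℕ) :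
    IsZeroSumSeq G0 (n • A) := by
  induction n with
  | zero => simp [IsZeroSumSeq]
  | succ n ih => rw [succ_nsmul]; exact isZeroSumSeq_add ih hA

/-- `min Δ(G₀)` divides all differences of lengths. -/
theorem sInf_delta_dvd {G0 : Set G} (hne : deltaG0 G0 ≠ ∅) {B : Multiset G}
    (hB : IsZeroSumSeq G0 B) {a b : ℕ} (ha : a ∈ lengthSet G0 B) (hb : b ∈ lengthSet G0 B)
    (hab : a ≤ b) : sInf (deltaG0 G0) ∣ b - a := by
  have hm := Nat.sInf_mem (Set.nonempty_iff_ne_empty.2 hne)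
  set m := sInf (deltaG0 G0) with hmdef
  obtain ⟨A, hA, hm0, c, hc, hcm, -⟩ := mem_deltaG0.1 hm
  by_contra hnd
  have hr : 0 < (b - a) % m := Nat.pos_of_ne_zero fun h => hnd (Nat.dvd_of_mod_eq_zero h)
  have hrm : (b - a) % m < m := Nat.mod_lt _ hm0
  have hdiv := Nat.div_add_mod (b - a) m
  set q := (b - a) / m
  set r := (b - a) % m
  have h1 := lengthSet_add hb (lengthSet_nsmul hc q)
  have h2 := lengthSet_add ha (lengthSet_nsmul hcm q)
  have e1 : b + q * c = (a + q * (c + m)) + r := by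
    have : q * (c + m) = q * c + m * q := by ring
    omega
  obtain ⟨e, he, hle⟩ := exists_delta h2 h1 (by omega)
  have : m ≤ e := Nat.sInf_le (mem_deltaG0.2 ⟨_, isZeroSumSeq_add hB (isZeroSumSeq_nsmul hA q), he⟩)
  omega

theorem bddAbove_lengthSet (G0 : Set G) (B : Multiset G) : BddAbove (lengthSet G0 B) :=
  ⟨Multiset.card B, fun _ h => length_le_card h⟩

theorem rhoL_le [Fintype G] (G0 : Set G) {L : Set ℕ} (hL : L ∈ systemL G0) :
    rhoL L ≤ Fintype.card G := by
  have hpos : 0 < Fintype.card G := Fintype.card_pos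
  obtain ⟨B, hB, rfl⟩ := hL
  unfold rhoL
  split_ifs with h
  · exact_mod_cast hpos
  · have hne : (lengthSet G0 B).Nonempty := by
      by_contra hn
      rw [Set.not_nonempty_iff_eq_empty] at hn
      rw [hn] at h; simp at h
    have h1 := Nat.sInf_mem hne
    have h2 := Nat.sSup_mem hne (bddAbove_lengthSet G0 B)
    have h3 := (length_le_card h2).trans (card_le_length h1)
    rw [div_le_iff₀ (by exact_mod_cast Nat.pos_of_ne_zero h)]
    exact_mod_cast h3

theorem bddAbove_rho [Fintype G] (G0 : Set G) : BddAbove (rhoL '' systemL G0) :=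
  ⟨Fintype.card G, by rintro _ ⟨L, hL, rfl⟩; exact rhoL_le G0 hL⟩

theorem rhoL_nonneg (L : Set ℕ) : 0 ≤ rhoL L := by
  unfold rhoL
  split_ifs <;> positivity

theorem rhoG0_nonneg (G0 : Set G) : 0 ≤ rhoG0 G0 := by
  apply Real.sSup_nonneg
  rintro _ ⟨L, _, rfl⟩
  exact rhoL_nonneg L

theorem le_rho_mul [Fintype G] {G0 : Set G} {B : Multiset G} (hB : IsZeroSumSeq G0 B) {a b : ℕ}
    (ha : a ∈ lengthSet G0 B) (hb : b ∈ lengthSet G0 B) : (b : ℝ) ≤ rhoG0 G0 * a := by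
  have hle : rhoL (lengthSet G0 B) ≤ rhoG0 G0 :=
    le_csSup (bddAbove_rho G0) ⟨_, ⟨B, hB, rfl⟩, rfl⟩
  refine le_trans ?_ (mul_le_mul_of_nonneg_right hle (Nat.cast_nonneg a))
  have h1 := Nat.sInf_mem ⟨a, ha⟩
  have h2 : b ≤ sSup (lengthSet G0 B) := le_csSup (bddAbove_lengthSet G0 B) hb
  have h3 : sInf (lengthSet G0 B) ≤ a := Nat.sInf_le ha
  unfold rhoL
  split_ifs with h
  · rw [h] at h1
    have h4 := (length_le_card hb).trans (card_le_length h1)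
    have : b = 0 := by simpa using h4
    subst this; simp
  · have hp : (0 : ℝ) < (sInf (lengthSet G0 B) : ℕ) := by exact_mod_cast Nat.pos_of_ne_zero h
    rw [div_mul_eq_mul_div, le_div_iff₀ hp]
    have h2' : (b : ℝ) ≤ (sSup (lengthSet G0 B) : ℕ) := by exact_mod_cast h2
    have h3' : ((sInf (lengthSet G0 B) : ℕ) : ℝ) ≤ a := by exact_mod_cast h3
    exact mul_le_mul h2' h3' hp.le (Nat.cast_nonneg _)

/-- Characterisation of `ρ*` through the system of sets of lengths only. -/
def LongWith (S : Set (Set ℕ)) (d : ℕ) (x : ℝ) : Prop :=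
  ∀ k : ℕ, ∃ L ∈ S, (∀ a ∈ L, ∀ b ∈ L, a ≤ b → d ∣ b - a) ∧
    ∃ a ∈ L, ∃ b ∈ L, a + k ≤ b ∧ x * a ≤ b

theorem longWith_of_lt {G0 : Set G} {d : ℕ} {x : ℝ} (hne : deltaG0 G0 ≠ ∅)
    (hd : d ∣ sInf (deltaG0 G0)) (hx : x < rhoG0 G0) :
    LongWith (systemL (Set.univ : Set G)) d x := by
  have key : ∃ B, IsZeroSumSeq G0 B ∧ ∃ a ∈ lengthSet G0 B, ∃ b ∈ lengthSet G0 B,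
      a < b ∧ x * a ≤ b := by
    rcases lt_or_ge x 1 with h1 | h1
    · obtain ⟨A, hA, hm0, c, hc, hcm, -⟩ :=
        mem_deltaG0.1 (Nat.sInf_mem (Set.nonempty_iff_ne_empty.2 hne))
      refine ⟨A, hA, c, hc, _, hcm, by omega, ?_⟩
      have : x * c ≤ 1 * c := mul_le_mul_of_nonneg_right h1.le (Nat.cast_nonneg c)
      push_cast
      have h2 : (0 : ℝ) ≤ (sInf (deltaG0 G0) : ℕ) := Nat.cast_nonneg _
      linarith
    · have hne' : (rhoL '' systemL G0).Nonempty :=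
        ⟨_, _, ⟨0, by simp [IsZeroSumSeq], rfl⟩, rfl⟩
      obtain ⟨_, ⟨L, ⟨B, hB, rfl⟩, rfl⟩, hlt⟩ := exists_lt_of_lt_csSup hne' hx
      unfold rhoL at hlt
      split_ifs at hlt with h
      · linarith
      · have hnn : (lengthSet G0 B).Nonempty := by
          by_contra hn
          rw [Set.not_nonempty_iff_eq_empty] at hn
          rw [hn] at h; simp at h
        have hp : (0 : ℝ) < (sInf (lengthSet G0 B) : ℕ) := by
          exact_mod_cast Nat.pos_of_ne_zero h
        rw [lt_div_iff₀ hp] at hlt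
        refine ⟨B, hB, _, Nat.sInf_mem hnn, _, Nat.sSup_mem hnn (bddAbove_lengthSet G0 B), ?_,
          hlt.le⟩
        have : ((sInf (lengthSet G0 B) : ℕ) : ℝ) < (sSup (lengthSet G0 B) : ℕ) := by nlinarith
        exact_mod_cast this
  obtain ⟨B, hB, a, ha, b, hb, hab, hxab⟩ := key
  intro k
  have hkB := isZeroSumSeq_nsmul hB k
  refine ⟨lengthSet G0 (k • B), ⟨k • B, ⟨fun _ _ => Set.mem_univ _, hkB.2⟩,
    (lengthSet_univ_eq hkB.1).symm⟩, fun u hu v hv huv => hd.trans (sInf_delta_dvd hne hkB hu hv huv),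
    k * a, lengthSet_nsmul ha k, k * b, lengthSet_nsmul hb k, ?_, ?_⟩
  · nlinarith
  · push_cast
    have : (0 : ℝ) ≤ k := Nat.cast_nonneg k
    nlinarith

theorem extract [Fintype G] (f : ℕ → G → ℕ) : ∃ (G0 : Set G) (N : ℕ), ∀ M, ∃ k ≥ M,
    (∀ g ∈ G0, M ≤ f k g) ∧ ∀ g ∉ G0, f k g ≤ N := by
  let P : Set G → Prop := fun S => ∀ M, ∃ k ≥ M, ∀ g ∈ S, M ≤ f k g
  have hP : P ∅ := fun M => ⟨M, le_rfl, by simp⟩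
  obtain ⟨G0, hG0⟩ := (Set.toFinite {S | P S}).exists_maximal ⟨∅, hP⟩
  have hmax : ∀ g, ∃ m, g ∉ G0 → ∀ k ≥ m, ¬ ∀ h ∈ insert g G0, m ≤ f k h := by
    intro g
    by_cases hg : g ∈ G0
    · exact ⟨0, fun h => absurd hg h⟩
    · have : ¬ P (insert g G0) := fun hp =>
        hg (hG0.2 hp (Set.subset_insert _ _) (Set.mem_insert _ _))
      simp only [P] at this
      push Not at this
      obtain ⟨m, hm⟩ := this
      refine ⟨m, fun _ k hk hcon => ?_⟩
      obtain ⟨h, hh, hlt⟩ := hm k hk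
      exact absurd (hcon h hh) (by omega)
  choose m hm using hmax
  have hmle : ∀ g, m g ≤ ∑ g, m g := fun g => Finset.single_le_sum (f := m) (by simp) (Finset.mem_univ g)
  refine ⟨G0, ∑ g, m g, fun M => ?_⟩
  obtain ⟨k, hk, hf⟩ := hG0.1 (max M (∑ g, m g))
  refine ⟨k, (le_max_left _ _).trans hk, fun g hg => (le_max_left _ _).trans (hf g hg), ?_⟩
  intro g hg
  by_contra hcon
  push Not at hcon
  refine hm g hg k ((hmle g).trans ((le_max_right _ _).trans hk)) ?_
  rintro h (rfl | hh)
  · exact (hmle _).trans hcon.le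
  · exact (hmle g).trans ((le_max_right _ _).trans (hf h hh))

/-- Passing from `B` to a zero-sum sequence over `G₀`, with controlled loss. -/
theorem reduce [Fintype G] (G0 : Set G) (N : ℕ) {B : Multiset G}
    (hN : ∀ g ∉ G0, B.count g ≤ N) {a b : ℕ}
    (ha : a ∈ lengthSet (Set.univ : Set G) B) (hb : b ∈ lengthSet (Set.univ : Set G) B) :
    ∃ T, IsZeroSumSeq G0 T ∧ ∃ a' ∈ lengthSet G0 T, ∃ b' ∈ lengthSet G0 T,
      b ≤ b' + N * Fintype.card G ∧
      a' ≤ a + Fintype.card G * (Fintype.card G * (N * Fintype.card G)) := by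
  set D := Fintype.card G
  rw [mem_lengthSet_iff] at ha hb
  obtain ⟨V, rfl, hV, hVs⟩ := hb
  obtain ⟨W, rfl, hW, hWs⟩ := ha
  set R := B.filter (fun g => g ∉ G0) with hR
  have hRc : Multiset.card R ≤ N * D := by
    rw [← Multiset.toFinset_sum_count_eq, mul_comm]
    calc ∑ g ∈ R.toFinset, R.count g ≤ ∑ g ∈ R.toFinset, N := by
          refine Finset.sum_le_sum fun g hg => ?_
          rw [Multiset.mem_toFinset, hR, Multiset.mem_filter] at hg
          exact (Multiset.count_le_of_le g (Multiset.filter_le _ _)).trans (hN g hg.2)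
      _ = R.toFinset.card * N := by simp
      _ ≤ D * N := Nat.mul_le_mul_right _ (Finset.card_le_univ _)
  obtain ⟨J, hJ, hJc, hJs⟩ := cover V R (by rw [hVs]; exact Multiset.filter_le _ _)
  obtain ⟨V', rfl⟩ := Multiset.le_iff_exists_add.1 hJ
  have hsum0 : ∀ X : Multiset (Multiset G), (∀ U ∈ X, IsMinZeroSum (Set.univ : Set G) U) →
      X.sum.sum = 0 := by
    intro X hX
    induction X using Multiset.induction_on with
    | empty => simp
    | cons U X ih =>
      rw [Multiset.sum_cons, Multiset.sum_add, ih fun U hU => hX U (Multiset.mem_cons_of_mem hU),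
        (hX U (Multiset.mem_cons_self _ _)).2.2.1, add_zero]
  set T := V'.sum with hTdef
  have hB : B = J.sum + T := by rw [← hVs, Multiset.sum_add]
  have hTG : ∀ g ∈ T, g ∈ G0 := by
    intro g hg
    by_contra hgn
    have h1 : R.count g = B.count g := by rw [hR]; exact Multiset.count_filter_of_pos (p := fun g => g ∉ G0) hgn
    have h2 := Multiset.count_le_of_le g hJs
    have h3 : B.count g = J.sum.count g + T.count g := by rw [hB, Multiset.count_add]
    have h4 := Multiset.count_pos.2 hg
    omega
  have hT0 : T.sum = 0 := hsum0 V' fun U hU => hV U (by simp [hU])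
  have hTz : IsZeroSumSeq G0 T := ⟨hTG, hT0⟩
  have hb' : Multiset.card V' ∈ lengthSet G0 T := by
    apply lengthSet_restrict (G1 := Set.univ) hTG
    rw [mem_lengthSet_iff]
    exact ⟨V', rfl, fun U hU => hV U (by simp [hU]), rfl⟩
  have hJcard : Multiset.card J.sum ≤ D * (N * D) :=
    (sum_card_le J D fun U hU => atom_card_le (hV U (by simp [hU]))).trans
      (Nat.mul_le_mul_left _ (hJc.trans hRc))
  obtain ⟨I, hI, hIc, hIs⟩ := cover W J.sum (by rw [hWs, hB]; exact Multiset.le_add_right _ _)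
  obtain ⟨W', rfl⟩ := Multiset.le_iff_exists_add.1 hI
  rw [Multiset.sum_add] at hWs
  obtain ⟨Q, hQ⟩ := Multiset.le_iff_exists_add.1 hIs
  have hTQ : T = Q + W'.sum := by
    have : J.sum + T = J.sum + (Q + W'.sum) := by rw [← hB, ← hWs, hQ, add_assoc]
    exact add_left_cancel this
  have hW'0 : W'.sum.sum = 0 := hsum0 W' fun U hU => hW U (by simp [hU])
  have hQ0 : Q.sum = 0 := by
    rw [hTQ, Multiset.sum_add, hW'0, add_zero] at hT0; exact hT0
  have hQG : ∀ g ∈ Q, g ∈ G0 := fun g hg => hTG g (by rw [hTQ]; simp [hg])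
  have hWG : ∀ g ∈ W'.sum, g ∈ G0 := fun g hg => hTG g (by rw [hTQ, Multiset.mem_add]; exact Or.inr hg)
  obtain ⟨q, hq⟩ := exists_length _ Q le_rfl ⟨hQG, hQ0⟩
  have hw : Multiset.card W' ∈ lengthSet G0 W'.sum := by
    apply lengthSet_restrict (G1 := Set.univ) hWG
    rw [mem_lengthSet_iff]
    exact ⟨W', rfl, fun U hU => hW U (by simp [hU]), rfl⟩
  have hqle : q ≤ D * (D * (N * D)) := by
    have h1 := length_le_card hq
    have h2 : Multiset.card Q ≤ Multiset.card I.sum := by rw [hQ, Multiset.card_add]; omega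
    have h3 := sum_card_le I D fun U hU => atom_card_le (hW U (by simp [hU]))
    have h4 : D * Multiset.card I ≤ D * (D * (N * D)) := Nat.mul_le_mul_left _ (hIc.trans hJcard)
    omega
  refine ⟨T, hTz, q + Multiset.card W', by rw [hTQ]; exact lengthSet_add hq hw, _, hb', ?_, ?_⟩
  · rw [Multiset.card_add]; omega
  · rw [Multiset.card_add]; omega

theorem exists_of_longWith [Fintype G] {d : ℕ} {x : ℝ}
    (h : LongWith (systemL (Set.univ : Set G)) d x) :
    ∃ G0 : Set G, deltaG0 G0 ≠ ∅ ∧ d ∣ sInf (deltaG0 G0) ∧ x ≤ rhoG0 G0 := by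
  have h' : ∀ k : ℕ, ∃ B : Multiset G, IsZeroSumSeq Set.univ B ∧
      (∀ a ∈ lengthSet Set.univ B, ∀ b ∈ lengthSet Set.univ B, a ≤ b → d ∣ b - a) ∧
      ∃ a ∈ lengthSet Set.univ B, ∃ b ∈ lengthSet Set.univ B, a + k ≤ b ∧ x * a ≤ b := by
    intro k
    obtain ⟨L, ⟨B, hB, rfl⟩, h1, h2⟩ := h k
    exact ⟨B, hB, h1, h2⟩
  choose B hB hdvd a ha b hb hab hxab using h'
  obtain ⟨G0, N, hGN⟩ := extract fun k g => (B k).count g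
  set D := Fintype.card G with hD
  set C := N * D with hC
  set E := D * (D * C) with hE
  have hne : deltaG0 G0 ≠ ∅ := by
    obtain ⟨k, hk, -, hf⟩ := hGN (C + E + 1)
    obtain ⟨T, hT, a', ha', b', hb', h1, h2⟩ := reduce G0 N hf (ha k) (hb k)
    rw [← hD, ← hC] at h1
    rw [← hD, ← hC, ← hE] at h2
    have h3 := hab k
    obtain ⟨e, he, -⟩ := exists_delta ha' hb' (by omega)
    exact Set.nonempty_iff_ne_empty.1 ⟨e, mem_deltaG0.2 ⟨T, hT, he⟩⟩
  refine ⟨G0, hne, ?_, ?_⟩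
  · obtain ⟨A, hA, hm0, c, hc, hcm, -⟩ :=
      mem_deltaG0.1 (Nat.sInf_mem (Set.nonempty_iff_ne_empty.2 hne))
    obtain ⟨k, hk, hf, -⟩ := hGN (Multiset.card A)
    have hle : A ≤ B k := by
      rw [Multiset.le_iff_count]
      intro g
      by_cases hg : g ∈ A
      · exact (Multiset.count_le_card _ _).trans (hf g (hA.1 g hg))
      · rw [Multiset.count_eq_zero_of_notMem hg]; exact Nat.zero_le _
    obtain ⟨R, hR⟩ := Multiset.le_iff_exists_add.1 hle
    have hR0 : R.sum = 0 := by
      have := (hB k).2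
      rw [hR, Multiset.sum_add, hA.2, zero_add] at this; exact this
    obtain ⟨r, hr⟩ := exists_length (G0 := Set.univ) _ R le_rfl ⟨fun _ _ => Set.mem_univ _, hR0⟩
    have h1 := lengthSet_add (lengthSet_mono (Set.subset_univ _) hc) hr
    have h2 := lengthSet_add (lengthSet_mono (Set.subset_univ _) hcm) hr
    rw [← hR] at h1 h2
    have h3 := hdvd k _ h1 _ h2 (by omega)
    have h4 : c + sInf (deltaG0 G0) + r - (c + r) = sInf (deltaG0 G0) := by omega
    rwa [h4] at h3
  · by_contra hcon
    push Not at hcon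
    set ρ := rhoG0 G0 with hρ
    have hρ0 : 0 ≤ ρ := rhoG0_nonneg G0
    obtain ⟨M, hM⟩ := exists_nat_gt (D * (ρ * E + C) / (x - ρ))
    rw [div_lt_iff₀ (by linarith)] at hM
    obtain ⟨k, hk, -, hf⟩ := hGN M
    obtain ⟨T, hT, a', ha', b', hb', h1, h2⟩ := reduce G0 N hf (ha k) (hb k)
    rw [← hD, ← hC] at h1
    rw [← hD, ← hC, ← hE] at h2
    have h3 := le_rho_mul hT ha' hb'
    have h4 := hxab k
    have h5 : M ≤ D * a k := by
      have := (length_le_card (hb k)).trans (card_le_length (ha k))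
      rw [← hD] at this
      have := hab k
      omega
    have h1' : (b k : ℝ) ≤ b' + C := by exact_mod_cast h1
    have h2' : (a' : ℝ) ≤ a k + E := by exact_mod_cast h2
    have h5' : (M : ℝ) ≤ D * a k := by exact_mod_cast h5
    have h6 : ρ * a' ≤ ρ * (a k + E) := mul_le_mul_of_nonneg_left h2' hρ0
    have h7 : (x - ρ) * a k ≤ ρ * E + C := by linarith
    have h8 : (D : ℝ) * ((x - ρ) * a k) ≤ D * (ρ * E + C) :=
      mul_le_mul_of_nonneg_left h7 (Nat.cast_nonneg _)
    have h9 : (M : ℝ) * (x - ρ) ≤ D * a k * (x - ρ) :=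
      mul_le_mul_of_nonneg_right h5' (by linarith)
    linarith

theorem rhoStar_le {G G' : Type*} [AddCommGroup G] [Fintype G] [AddCommGroup G'] [Fintype G']
    (hL : systemL (Set.univ : Set G) = systemL (Set.univ : Set G')) (d : ℕ) :
    rhoStar G d ≤ rhoStar G' d := by
  have hnn : 0 ≤ rhoStar G' d := by
    apply Real.sSup_nonneg
    rintro _ ⟨G0, -, -, rfl⟩
    exact rhoG0_nonneg G0
  have hbdd : BddAbove {x | ∃ G0 : Set G', deltaG0 G0 ≠ ∅ ∧ d ∣ sInf (deltaG0 G0) ∧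
      x = rhoG0 G0} := by
    refine ⟨Fintype.card G', ?_⟩
    rintro _ ⟨G0, -, -, rfl⟩
    apply Real.sSup_le _ (Nat.cast_nonneg _)
    rintro _ ⟨L, hL, rfl⟩
    exact rhoL_le G0 hL
  apply Real.sSup_le _ hnn
  rintro _ ⟨G0, hne, hd, rfl⟩
  apply le_of_forall_lt
  intro x hx
  obtain ⟨y, hxy, hy⟩ := exists_between hx
  have h1 := longWith_of_lt hne hd hy
  rw [hL] at h1
  obtain ⟨G1, hne1, hd1, hle⟩ := exists_of_longWith h1
  exact hxy.trans_le (hle.trans (le_csSup hbdd ⟨G1, hne1, hd1, rfl⟩))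

end Helpers

theorem stmt15 {G G' : Type*} [AddCommGroup G] [Fintype G] [AddCommGroup G'] [Fintype G']
    (hD : 4 ≤ davenport G)
    (hL : systemL (Set.univ : Set G) = systemL (Set.univ : Set G')) :
    ∀ d ∈ delta1 G,
      d ∈ delta1 G' ∧ rhoGd G d = rhoGd G' d ∧ rhoStar G d = rhoStar G' d := by
  intro d hd
  refine ⟨?_, ?_, le_antisymm (rhoStar_le hL d) (rhoStar_le hL.symm d)⟩
  · unfold delta1 at hd ⊢
    rw [← hL]
    exact hd
  · unfold rhoGd rhoGdk
    rw [hL]
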